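/- There exist absolute constants c, C > 0 (independent of d and n) such that for every d ≥ 1 and every n ≥ 1: (i) if 1 ≤ n ≤ d then c ≤ σ^∞_d(n) ≤ C; (ii) if d ≤ n ≤ 3^d and n ≥ 2 then c·(log(1 + d/log n)/log n)^{1/2} ≤ σ^∞_d(n) ≤ C·(log(1 + d/log n)/log n)^{1/2}; and (iii) σ^∞_d(n) = 0 for n > 3^d. Here log denotes the base-2 logarithm. -/

import Mathlib

/-- nonincreasing rearrangement of the weights `(1 + Σ_j |k_j|)^{-1/2}`, `k ∈ {-1,0,1}^d`. -/
noncomputable def sigmaInf (d : ℕ) (n : ℕ) : ℝ :=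
  sSup {t : ℝ | 0 < t ∧
    n ≤ Set.ncard {k : Fin d → ℤ | (∀ j, |k j| ≤ 1) ∧
      t ≤ (1 + ∑ j, |(k j : ℝ)|) ^ (-(1 / 2) : ℝ)}}

/-- The points `k ∈ {-1,0,1}^d` with `Σ_j |k_j| ≤ M`. -/
def signBall (d : ℕ) (M : ℝ) : Set (Fin d → ℤ) :=
  {k | (∀ j, |k j| ≤ 1) ∧ ∑ j, |(k j : ℝ)| ≤ M}

lemma setOf_abs_le_one_eq (d : ℕ) :
    {k : Fin d → ℤ | ∀ j, |k j| ≤ 1} =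
      (Fintype.piFinset fun _ : Fin d => Finset.Icc (-1 : ℤ) 1) := by
  ext k
  simp [abs_le, forall_and, Pi.le_def]

lemma ncard_setOf_abs_le_one (d : ℕ) : {k : Fin d → ℤ | ∀ j, |k j| ≤ 1}.ncard = 3 ^ d := by
  rw [setOf_abs_le_one_eq, Set.ncard_coe_finset, Fintype.card_piFinset]
  simp

lemma finite_setOf_abs_le_one (d : ℕ) : {k : Fin d → ℤ | ∀ j, |k j| ≤ 1}.Finite := by
  rw [setOf_abs_le_one_eq]
  exact Finset.finite_toSet _

lemma signBall_finite (d : ℕ) (M : ℝ) : (signBall d M).Finite :=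
  (finite_setOf_abs_le_one d).subset fun _ hk => hk.1

lemma le_rpow_neg_half_iff {t x : ℝ} (ht : 0 < t) (hx : 0 < x) :
    t ≤ x ^ (-(1 / 2) : ℝ) ↔ x ≤ (t ^ 2)⁻¹ := by
  rw [Real.rpow_neg hx.le, ← Real.sqrt_eq_rpow, le_inv_comm₀ ht (Real.sqrt_pos.2 hx),
    Real.sqrt_le_left (inv_pos.2 ht).le, inv_pow]

lemma one_add_sum_abs_pos {d : ℕ} (k : Fin d → ℤ) : (0 : ℝ) < 1 + ∑ j, |(k j : ℝ)| := by
  positivity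

lemma setOf_le_weight_eq_signBall (d : ℕ) {t : ℝ} (ht : 0 < t) :
    {k : Fin d → ℤ | (∀ j, |k j| ≤ 1) ∧ t ≤ (1 + ∑ j, |(k j : ℝ)|) ^ (-(1 / 2) : ℝ)} =
      signBall d ((t ^ 2)⁻¹ - 1) := by
  ext k
  simp only [signBall, Set.mem_ofPred_eq, le_rpow_neg_half_iff ht (one_add_sum_abs_pos k),
    le_sub_iff_add_le']

lemma sigmaInf_eq (d n : ℕ) :
    sigmaInf d n = sSup {t : ℝ | 0 < t ∧ n ≤ (signBall d ((t ^ 2)⁻¹ - 1)).ncard} := by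
  unfold sigmaInf
  congr 1
  ext t
  simp only [Set.mem_ofPred_eq]
  exact and_congr_right fun ht => by rw [setOf_le_weight_eq_signBall d ht]

lemma nonneg_of_le_ncard_signBall {d n : ℕ} {M : ℝ} (hn : 1 ≤ n)
    (h : n ≤ (signBall d M).ncard) : 0 ≤ M := by
  obtain ⟨k, hk⟩ := Set.nonempty_of_ncard_ne_zero (by omega : (signBall d M).ncard ≠ 0)
  exact (Finset.sum_nonneg fun j _ => abs_nonneg _).trans hk.2

lemma le_one_of_le_ncard_signBall {d n : ℕ} {t : ℝ} (hn : 1 ≤ n) (ht : 0 < t)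
    (h : n ≤ (signBall d ((t ^ 2)⁻¹ - 1)).ncard) : t ≤ 1 := by
  have h1 : 1 ≤ (t ^ 2)⁻¹ := by linarith [nonneg_of_le_ncard_signBall hn h]
  rw [one_le_inv₀ (by positivity)] at h1
  exact (sq_le_one_iff₀ ht.le).1 h1

lemma sigmaInf_le_one {d n : ℕ} (hn : 1 ≤ n) : sigmaInf d n ≤ 1 := by
  rw [sigmaInf_eq]
  exact Real.sSup_le (fun t ht => le_one_of_le_ncard_signBall hn ht.1 ht.2) zero_le_one

lemma le_sigmaInf {d n : ℕ} {t M : ℝ} (hn : 1 ≤ n) (ht : 0 < t) (hM : t ^ 2 * (1 + M) ≤ 1)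
    (h : n ≤ (signBall d M).ncard) : t ≤ sigmaInf d n := by
  rw [sigmaInf_eq]
  refine le_csSup ⟨1, fun t ht => le_one_of_le_ncard_signBall hn ht.1 ht.2⟩ ⟨ht, h.trans ?_⟩
  refine Set.ncard_le_ncard (fun k hk => ⟨hk.1, hk.2.trans ?_⟩) (signBall_finite _ _)
  rw [le_sub_iff_add_le', ← one_div, le_div_iff₀' (by positivity)]
  exact hM

lemma sigmaInf_le {d n : ℕ} {B : ℝ} (hB : 0 ≤ B)
    (h : ∀ M : ℝ, n ≤ (signBall d M).ncard → 1 ≤ B ^ 2 * (1 + M)) : sigmaInf d n ≤ B := by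
  rw [sigmaInf_eq]
  refine Real.sSup_le (fun t ht => ?_) hB
  have h1 := h _ ht.2
  have h2 : 0 < t ^ 2 := pow_pos ht.1 2
  rw [add_sub_cancel, ← div_eq_mul_inv, le_div_iff₀ h2, one_mul] at h1
  exact (sq_le_sq₀ ht.1.le hB).1 h1

lemma sigmaInf_eq_zero {d n : ℕ} (hn : 3 ^ d < n) : sigmaInf d n = 0 := by
  rw [sigmaInf_eq]
  convert Real.sSup_empty
  refine Set.eq_empty_of_forall_notMem fun t ht => absurd ht.2 (not_le.2 (lt_of_le_of_lt ?_ hn))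
  rw [← ncard_setOf_abs_le_one]
  exact Set.ncard_le_ncard (fun k hk => hk.1) (finite_setOf_abs_le_one d)

lemma three_pow_le_ncard_signBall {d m : ℕ} (h : d ≤ m) : 3 ^ d ≤ (signBall d m).ncard := by
  rw [← ncard_setOf_abs_le_one]
  refine Set.ncard_le_ncard (fun k hk => ⟨hk, ?_⟩) (signBall_finite _ _)
  calc ∑ j, |(k j : ℝ)| ≤ ∑ _j : Fin d, (1 : ℝ) :=
        Finset.sum_le_sum fun j _ => by exact_mod_cast hk j
    _ ≤ m := by simpa using h

/-- A choice, in each of `m` blocks of length `q`, of a position and a sign. -/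
def blockVector {m q : ℕ} (f : Fin m → Fin q × Bool) (p : Fin m × Fin q) : ℤ :=
  if (f p.1).1 = p.2 then (if (f p.1).2 then 1 else -1) else 0

lemma blockVector_injective (m q : ℕ) : Function.Injective (@blockVector m q) := by
  intro f g h
  funext i
  have hi := congrFun h (i, (f i).1)
  by_cases hg : (g i).1 = (f i).1
  · refine Prod.ext hg.symm ?_
    simp only [blockVector, hg, if_true] at hi
    cases hf2 : (f i).2 <;> cases hg2 : (g i).2 <;> simp_all
  · simp only [blockVector, hg, if_true, if_false] at hi
    split_ifs at hi
    all_goals simp at hi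

lemma abs_blockVector {m q : ℕ} (f : Fin m → Fin q × Bool) (p : Fin m × Fin q) :
    |blockVector f p| = if (f p.1).1 = p.2 then 1 else 0 := by
  unfold blockVector
  split_ifs <;> simp

lemma pow_le_ncard_signBall {d m q : ℕ} (h : m * q ≤ d) :
    (2 * q) ^ m ≤ (signBall d m).ncard := by
  let e : Fin m × Fin q → Fin d := fun p => Fin.castLE h (finProdFinEquiv p)
  have he : Function.Injective e := (Fin.castLE_injective h).comp finProdFinEquiv.injective
  let F : (Fin m → Fin q × Bool) → Fin d → ℤ := fun f => Function.extend e (blockVector f) 0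
  have hF : Function.Injective F := fun f g hfg =>
    blockVector_injective m q <| funext fun p => by
      simpa [F, he.extend_apply] using congrFun hfg (e p)
  have hcard : (Set.range F).ncard = (2 * q) ^ m := by
    rw [← Set.image_univ, Set.ncard_image_of_injective _ hF, Set.ncard_univ]
    simp [mul_comm]
  rw [← hcard]
  refine Set.ncard_le_ncard ?_ (signBall_finite _ _)
  rintro _ ⟨f, rfl⟩
  have hzero : ∀ j, j ∉ Set.range e → F f j = 0 := fun j hj => by
    simp only [F]
    rw [Function.extend_apply' _ _ _ (by simpa using hj)]
    rfl
  constructor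
  · intro j
    by_cases hj : j ∈ Set.range e
    · obtain ⟨p, rfl⟩ := hj
      simp only [F, he.extend_apply, abs_blockVector]
      split_ifs <;> simp
    · simp [hzero j hj]
  · have hsum : ∑ p, |blockVector f p| = ∑ j, |F f j| :=
      Fintype.sum_of_injective e he _ _ (fun j hj => by simp [hzero j hj])
        fun p => by simp [F, he.extend_apply]
    have hm : ∑ p, |blockVector f p| = m := by
      simp only [abs_blockVector, Fintype.sum_prod_type]
      simp
    exact_mod_cast (hsum.symm.trans hm).le

lemma ncard_signBall_le (d : ℕ) (M : ℝ) {s : ℝ} (hs : 1 ≤ s) :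
    ((signBall d M).ncard : ℝ) ≤ s ^ M * (1 + 2 / s) ^ d := by
  have hs0 : 0 < s := by linarith
  have hsub : signBall d M ⊆ (Fintype.piFinset fun _ : Fin d => Finset.Icc (-1 : ℤ) 1) := by
    rw [← setOf_abs_le_one_eq]
    exact fun k hk => hk.1
  have hfin := signBall_finite d M
  have hgen : ∑ k ∈ Fintype.piFinset fun _ : Fin d => Finset.Icc (-1 : ℤ) 1,
      ∏ j, s ^ (-|(k j : ℝ)|) = (1 + 2 / s) ^ d := by
    rw [Finset.sum_prod_piFinset (Finset.Icc (-1 : ℤ) 1) fun _ z => s ^ (-|(z : ℝ)|)]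
    have : Finset.Icc (-1 : ℤ) 1 = {-1, 0, 1} := rfl
    simp only [this, Finset.prod_const, Finset.card_univ, Fintype.card_fin]
    congr 1
    simp [Real.rpow_neg_one]
    ring
  rw [Set.ncard_eq_toFinset_card _ hfin, ← hgen, Finset.card_eq_sum_ones, Finset.mul_sum]
  push_cast
  calc ∑ k ∈ hfin.toFinset, (1 : ℝ)
      ≤ ∑ k ∈ hfin.toFinset, s ^ M * ∏ j, s ^ (-|(k j : ℝ)|) := by
        refine Finset.sum_le_sum fun k hk => ?_
        have hk := ((Set.Finite.mem_toFinset _).1 hk).2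
        rw [← Real.rpow_sum_of_pos hs0, ← Real.rpow_add hs0, Finset.sum_neg_distrib]
        exact Real.one_le_rpow hs (by linarith)
    _ ≤ _ := Finset.sum_le_sum_of_subset_of_nonneg (by simpa using hsub)
        fun k _ _ => by positivity

/-- The bounds on `log n` and `log (1 + d / log n)` valid in the range `d ≤ n ≤ 3 ^ d`. -/
lemma logb_bounds {d n : ℕ} (hdn : d ≤ n) (hn3 : n ≤ 3 ^ d) (hn : 2 ≤ n) :
    1 ≤ Real.logb 2 n ∧ 1 / 2 ≤ Real.logb 2 (1 + d / Real.logb 2 n) ∧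
      Real.logb 2 (1 + d / Real.logb 2 n) ≤ 2 * Real.logb 2 n := by
  have hn' : (2 : ℝ) ≤ n := by exact_mod_cast hn
  have hL : 1 ≤ Real.logb 2 n := by
    rw [Real.le_logb_iff_rpow_le one_lt_two (by linarith)]
    simpa using hn'
  have hLd : Real.logb 2 n ≤ 2 * d := by
    rw [Real.logb_le_iff_le_rpow one_lt_two (by linarith), Real.rpow_mul zero_le_two,
      Real.rpow_natCast]
    calc (n : ℝ) ≤ 3 ^ d := by exact_mod_cast hn3
      _ ≤ _ := pow_le_pow_left₀ (by norm_num) (by norm_num) _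
  have hx : 1 / 2 ≤ d / Real.logb 2 n := by
    rw [le_div_iff₀ (by linarith)]
    linarith
  refine ⟨hL, ?_, ?_⟩
  · rw [Real.le_logb_iff_rpow_le one_lt_two (by linarith), ← Real.sqrt_eq_rpow]
    exact (Real.sqrt_le_left (by linarith)).2 (by nlinarith)
  · rw [Real.logb_le_iff_le_rpow one_lt_two (by linarith), mul_comm, Real.rpow_mul zero_le_two,
      Real.rpow_logb two_pos (by norm_num) (by linarith)]
    have h1 : d / Real.logb 2 n ≤ d := div_le_self (by positivity) hL
    have h2 : (d : ℝ) ≤ n := by exact_mod_cast hdn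
    rw [Real.rpow_two]
    nlinarith

lemma logb_le_mul_of_le_ncard_signBall {d n : ℕ} {M : ℝ} (hdn : d ≤ n) (hn3 : n ≤ 3 ^ d)
    (hn : 2 ≤ n) (h : n ≤ (signBall d M).ncard) :
    Real.logb 2 n ≤ 14 * (M * Real.logb 2 (1 + d / Real.logb 2 n)) := by
  obtain ⟨hL, hl, -⟩ := logb_bounds hdn hn3 hn
  have hM := nonneg_of_le_ncard_signBall (by omega) h
  set L := Real.logb 2 n
  set x := (d : ℝ) / L with hx
  have hx0 : 0 ≤ x := by positivity
  have hcard : (n : ℝ) ≤ (8 * (1 + x)) ^ M * (1 + 2 / (8 * (1 + x))) ^ d :=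
    (Nat.cast_le.2 h).trans (ncard_signBall_le d M (by linarith))
  have hlog := Real.logb_le_logb_of_le one_lt_two (by positivity) hcard
  have h8 : Real.logb 2 8 = 3 := by
    rw [Real.logb_eq_iff_rpow_eq] <;> norm_num
  rw [Real.logb_mul (by positivity) (by positivity), Real.logb_rpow_eq_mul_logb_of_pos
    (by positivity), Real.logb_pow, Real.logb_mul (by norm_num) (by positivity), h8] at hlog
  have hfac : Real.logb 2 (1 + 2 / (8 * (1 + x))) ≤ 1 / (2 * (1 + x)) := by
    rw [← Real.log_div_log, div_le_iff₀ (Real.log_pos one_lt_two)]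
    have h1 := Real.log_le_sub_one_of_pos (x := 1 + 2 / (8 * (1 + x))) (by positivity)
    have h2 : 2 / (8 * (1 + x)) = 1 / (2 * (1 + x)) * (1 / 2) := by field_simp; norm_num
    have h3 : 1 / (2 * (1 + x)) * (1 / 2) ≤ 1 / (2 * (1 + x)) * Real.log 2 :=
      mul_le_mul_of_nonneg_left (by linarith [Real.log_two_gt_d9]) (by positivity)
    linarith
  have hd : (d : ℝ) * (1 / (2 * (1 + x))) ≤ L / 2 := by
    have : (d : ℝ) = x * L := by rw [hx]; field_simp
    rw [this, mul_one_div, div_le_iff₀ (by positivity)]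
    nlinarith
  have := mul_le_mul_of_nonneg_left hfac (Nat.cast_nonneg (α := ℝ) d)
  have := mul_le_mul_of_nonneg_left hl hM
  nlinarith

lemma le_ncard_signBall_ceil {d n : ℕ} (hdn : d ≤ n) (hn3 : n ≤ 3 ^ d) (hn : 2 ≤ n) :
    n ≤ (signBall d
      (⌈2 * Real.logb 2 n / Real.logb 2 (1 + d / Real.logb 2 n)⌉₊ : ℕ)).ncard := by
  obtain ⟨hL, hl, -⟩ := logb_bounds hdn hn3 hn
  have hn0 : (0 : ℝ) < n := by positivity
  set L := Real.logb 2 n with hLdef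
  set l := Real.logb 2 (1 + d / L) with hldef
  set m := ⌈2 * L / l⌉₊
  rcases le_total d m with hdm | hmd
  · exact hn3.trans (three_pow_le_ncard_signBall hdm)
  have hm : 2 * L / l ≤ m := Nat.le_ceil _
  have hm0 : 0 < m := Nat.ceil_pos.2 (by positivity)
  rw [div_le_iff₀ (by linarith)] at hm
  have hq : 1 ≤ d / m := (Nat.one_le_div_iff hm0).2 hmd
  have hqd : d < m * (d / m + 1) := Nat.lt_mul_div_succ d hm0
  refine le_trans ?_ (pow_le_ncard_signBall (Nat.mul_div_le d m))
  generalize d / m = q at hq hqd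
  have hq' : (1 : ℝ) ≤ q := by exact_mod_cast hq
  have hqd' : (d : ℝ) < m * (q + 1) := by exact_mod_cast hqd
  have key : L ≤ m * Real.logb 2 (2 * q) := by
    have h1 : 1 ≤ Real.logb 2 (2 * q) := by
      rw [Real.le_logb_iff_rpow_le one_lt_two (by linarith)]
      simpa using hq'
    rcases le_total L m with hLm | hmL
    · nlinarith
    have hx : d / L ≤ 2 * q := by
      rw [div_le_iff₀ (by linarith)]
      nlinarith
    have h2 : l ≤ 2 * Real.logb 2 (2 * q) := by
      have : (2 : ℝ) * Real.logb 2 (2 * q) = Real.logb 2 ((2 * q) ^ 2) := by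
        rw [Real.logb_pow]; norm_num
      rw [this]
      exact Real.logb_le_logb_of_le one_lt_two (by positivity) (by nlinarith)
    nlinarith [mul_le_mul_of_nonneg_left h2 (Nat.cast_nonneg (α := ℝ) m)]
  rw [← Real.logb_pow, hLdef,
    Real.logb_le_logb one_lt_two hn0 (by positivity)] at key
  exact_mod_cast key

/-- there are absolute constants `c, C > 0` such that for every
`d ≥ 1` and `n ≥ 1`: `c ≤ σ^∞_d(n) ≤ C` for `1 ≤ n ≤ d`,
`σ^∞_d(n) ≍ (log(1+d/log n)/log n)^{1/2}` for `d ≤ n ≤ 3^d` (base-2 logs), and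
`σ^∞_d(n) = 0` for `n > 3^d`. -/
theorem stmt_10 :
    ∃ c C : ℝ, 0 < c ∧ 0 < C ∧
      ∀ d : ℕ, 1 ≤ d → ∀ n : ℕ, 1 ≤ n →
        ((n ≤ d → c ≤ sigmaInf d n ∧ sigmaInf d n ≤ C) ∧
         (d ≤ n → n ≤ 3 ^ d → 2 ≤ n →
           c * (Real.logb 2 (1 + (d : ℝ) / Real.logb 2 n) / Real.logb 2 n) ^ ((1 : ℝ) / 2)
               ≤ sigmaInf d n ∧
             sigmaInf d n ≤
               C * (Real.logb 2 (1 + (d : ℝ) / Real.logb 2 n) / Real.logb 2 n) ^ ((1 : ℝ) / 2)) ∧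
         (3 ^ d < n → sigmaInf d n = 0)) := by
  refine ⟨1 / 3, 4, by norm_num, by norm_num, fun d hd n hn => ⟨fun hnd => ⟨?_, ?_⟩,
    fun hdn hn3 hn2 => ?_, sigmaInf_eq_zero⟩⟩
  · have h := pow_le_ncard_signBall (one_mul d).le
    exact le_sigmaInf hn (by norm_num) (by norm_num) ((by rw [pow_one]; omega : n ≤ (2 * d) ^ 1).trans h)
  · linarith [sigmaInf_le_one (d := d) hn]
  obtain ⟨hL, hl, hlL⟩ := logb_bounds hdn hn3 hn2
  have hball := le_ncard_signBall_ceil hdn hn3 hn2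
  have hupper := fun M => logb_le_mul_of_le_ncard_signBall (M := M) hdn hn3 hn2
  generalize Real.logb 2 (1 + (d : ℝ) / Real.logb 2 n) = l at *
  generalize Real.logb 2 (n : ℝ) = L at *
  have hL0 : 0 < L := by linarith
  have hl0 : 0 < l := by linarith
  rw [← Real.sqrt_eq_rpow]
  have hsq : Real.sqrt (l / L) ^ 2 = l / L := Real.sq_sqrt (by positivity)
  constructor
  · refine le_sigmaInf hn (by positivity) ?_ hball
    have hm := (Nat.ceil_lt_add_one (a := 2 * L / l) (by positivity)).le
    rw [mul_pow, hsq]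
    calc (1 / 3) ^ 2 * (l / L) * (1 + (⌈2 * L / l⌉₊ : ℝ))
        ≤ (1 / 3) ^ 2 * (l / L) * (1 + (2 * L / l + 1)) := by gcongr
      _ = (2 * L + 2 * l) / (9 * L) := by field_simp; ring
      _ ≤ 1 := by
        rw [div_le_one (by positivity)]
        linarith
  · refine sigmaInf_le (by positivity) fun M hM => ?_
    rw [mul_pow, hsq, mul_div_assoc', div_mul_eq_mul_div, one_le_div hL0]
    have h0 := mul_nonneg (nonneg_of_le_ncard_signBall hn hM) hl0.le
    nlinarith [hupper M hM]
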